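/- Let m ≥ 1 be an integer. There exists a constant C > 0, depending only on m, such that for all reals X ≥ 3 and Y, Z with 2 ≤ Y < Z ≤ X, one has ∑_{n ≤ X, gcd(n, P(Y,Z)) = 1} τ_m(n)² ≤ C · X · (log X)^{m² − 1} · ( (log Y) / (log Z) )^{m²}, where P(Y,Z) denotes the product of all primes p with Y ≤ p ≤ Z. -/

import Mathlib

noncomputable section

open scoped BigOperators

/-- The generalized divisor function `τ_m(n)`, the number of ways of writing `n`
as an ordered product of `m` positive integers. -/
def tauGen (m n : ℕ) : ℕ :=
  ((Fintype.piFinset fun _ : Fin m => Finset.Icc 1 n).filter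
    (fun d : Fin m → ℕ => ∏ i, d i = n)).card

/-- The product `P(Y,Z)` of all primes `p` with `Y ≤ p ≤ Z`. -/
def primeProdIcc (Y Z : ℝ) : ℕ :=
  ∏ p ∈ (Finset.range (⌊Z⌋₊ + 1)).filter
      (fun p : ℕ => p.Prime ∧ Y ≤ (p : ℝ) ∧ (p : ℝ) ≤ Z), p

/-- The indicator function of the positive integers coprime to `P`. -/
def coprimeIndicator (P : ℕ) : ArithmeticFunction ℝ :=
  ⟨fun n => if n ≠ 0 ∧ n.Coprime P then 1 else 0, by simp⟩

theorem coprimeIndicator_apply (P n : ℕ) :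
    coprimeIndicator P n = if n ≠ 0 ∧ n.Coprime P then 1 else 0 := rfl

theorem coprimeIndicator_nonneg (P n : ℕ) : 0 ≤ coprimeIndicator P n := by
  rw [coprimeIndicator_apply]; split_ifs <;> norm_num

theorem coprimeIndicator_le_one (P n : ℕ) : coprimeIndicator P n ≤ 1 := by
  rw [coprimeIndicator_apply]; split_ifs <;> norm_num

theorem coprimeIndicator_mul (P a b : ℕ) :
    coprimeIndicator P (a * b) = coprimeIndicator P a * coprimeIndicator P b := by
  simp only [coprimeIndicator_apply, Nat.coprime_mul_iff_left, mul_ne_zero_iff, ite_zero_mul_ite_zero,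
    mul_one]
  congr 1
  simp only [eq_iff_iff]
  tauto

theorem ArithmeticFunction.mul_apply_nonneg {f g : ArithmeticFunction ℝ} (hf : ∀ n, 0 ≤ f n)
    (hg : ∀ n, 0 ≤ g n) (n : ℕ) : 0 ≤ (f * g) n := by
  rw [ArithmeticFunction.mul_apply]
  exact Finset.sum_nonneg fun x _ => mul_nonneg (hf _) (hg _)

theorem ArithmeticFunction.pow_apply_nonneg {f : ArithmeticFunction ℝ} (hf : ∀ n, 0 ≤ f n)
    (k n : ℕ) : 0 ≤ (f ^ k) n := by
  induction k generalizing n with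
  | zero => rw [pow_zero, ArithmeticFunction.one_apply]; split_ifs <;> norm_num
  | succ k ih => rw [pow_succ]; exact mul_apply_nonneg ih hf n

theorem ArithmeticFunction.nsmul_apply (k : ℕ) (f : ArithmeticFunction ℝ) (n : ℕ) :
    (k • f) n = k * f n := by
  induction k with
  | zero => simp
  | succ k ih => rw [succ_nsmul, add_apply, ih]; push_cast; ring

theorem ArithmeticFunction.log_pmul_mul (f g : ArithmeticFunction ℝ) :
    log.pmul (f * g) = log.pmul f * g + f * log.pmul g := by
  ext n
  simp only [pmul_apply, add_apply, mul_apply, Finset.mul_sum, ← Finset.sum_add_distrib]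
  refine Finset.sum_congr rfl fun x hx => ?_
  obtain ⟨rfl, hn⟩ := Nat.mem_divisorsAntidiagonal.1 hx
  rw [log_apply, log_apply, log_apply, Nat.cast_mul, Real.log_mul]
  · ring
  · exact_mod_cast left_ne_zero_of_mul hn
  · exact_mod_cast right_ne_zero_of_mul hn

theorem log_pmul_coprimeIndicator (P : ℕ) :
    ArithmeticFunction.log.pmul (coprimeIndicator P) =
      ArithmeticFunction.vonMangoldt.pmul (coprimeIndicator P) * coprimeIndicator P := by
  ext n
  rw [ArithmeticFunction.pmul_apply, ArithmeticFunction.log_apply,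
    ← ArithmeticFunction.vonMangoldt_sum, Finset.sum_mul, ArithmeticFunction.mul_apply,
    ← Nat.sum_divisorsAntidiagonal
      (fun d _ => ArithmeticFunction.vonMangoldt d * coprimeIndicator P n)]
  refine Finset.sum_congr rfl fun x hx => ?_
  obtain ⟨rfl, hn⟩ := Nat.mem_divisorsAntidiagonal.1 hx
  rw [coprimeIndicator_mul, ArithmeticFunction.pmul_apply, mul_assoc]

theorem log_pmul_coprimeIndicator_pow (P k : ℕ) :
    ArithmeticFunction.log.pmul (coprimeIndicator P ^ k) =
      k • (ArithmeticFunction.vonMangoldt.pmul (coprimeIndicator P) * coprimeIndicator P ^ k) := by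
  induction k with
  | zero =>
    ext n
    by_cases h : n = 1 <;> simp [h]
  | succ k ih =>
    rw [pow_succ, ArithmeticFunction.log_pmul_mul, ih, log_pmul_coprimeIndicator]
    simp only [nsmul_eq_mul]
    push_cast
    ring

/-- The sum of `f n / n` is submultiplicative under Dirichlet convolution. -/
theorem ArithmeticFunction.sum_mul_div_le {f g : ArithmeticFunction ℝ} (hf : ∀ n, 0 ≤ f n)
    (hg : ∀ n, 0 ≤ g n) (N : ℕ) :
    ∑ n ∈ Finset.Ioc 0 N, (f * g) n / n ≤
      (∑ n ∈ Finset.Ioc 0 N, f n / n) * ∑ n ∈ Finset.Ioc 0 N, g n / n := by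
  let r : ArithmeticFunction ℝ → ArithmeticFunction ℝ := fun f => ⟨fun n => f n / n, by simp⟩
  have hr : ∀ f n, r f n = f n / n := fun f n => rfl
  have h : ∀ n, (f * g) n / n = (r f * r g) n := fun n => by
    rw [mul_apply, mul_apply, Finset.sum_div]
    refine Finset.sum_congr rfl fun x hx => ?_
    obtain ⟨rfl, hn⟩ := Nat.mem_divisorsAntidiagonal.1 hx
    rw [hr, hr, Nat.cast_mul, div_mul_div_comm]
  simp only [h, sum_Ioc_mul_eq_sum_sum, hr, Finset.sum_mul]
  refine Finset.sum_le_sum fun n hn => ?_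
  refine mul_le_mul_of_nonneg_left ?_ (div_nonneg (hf n) n.cast_nonneg)
  refine Finset.sum_le_sum_of_subset_of_nonneg
    (Finset.Ioc_subset_Ioc_right (Nat.div_le_self N n)) fun k _ _ => ?_
  exact div_nonneg (hg k) k.cast_nonneg

theorem ArithmeticFunction.sum_pow_div_le {f : ArithmeticFunction ℝ} (hf : ∀ n, 0 ≤ f n)
    (k N : ℕ) :
    ∑ n ∈ Finset.Ioc 0 N, (f ^ k) n / n ≤ (∑ n ∈ Finset.Ioc 0 N, f n / n) ^ k := by
  induction k with
  | zero =>
    simp only [pow_zero, one_apply, ite_div, zero_div, Finset.sum_ite_eq']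
    split_ifs <;> simp
  | succ k ih =>
    rw [pow_succ, pow_succ]
    refine (sum_mul_div_le (pow_apply_nonneg hf k) hf N).trans ?_
    gcongr
    exact Finset.sum_nonneg fun n _ => div_nonneg (hf n) n.cast_nonneg

theorem sum_coprimeIndicator_pow_mul_log_le (P k N : ℕ) :
    (∑ n ∈ Finset.Ioc 0 N, (coprimeIndicator P ^ k) n) * Real.log N ≤
      (k * (Real.log 4 + 4) + 1) * N * (∑ n ∈ Finset.Ioc 0 N, coprimeIndicator P n / n) ^ k := by
  have he := coprimeIndicator_nonneg P
  have hnn := ArithmeticFunction.pow_apply_nonneg he k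
  have hl4 : 0 ≤ Real.log 4 := Real.log_nonneg (by norm_num)
  have h1 : ∑ n ∈ Finset.Ioc 0 N, Real.log n * (coprimeIndicator P ^ k) n ≤
      k * (Real.log 4 + 4) * N * ∑ n ∈ Finset.Ioc 0 N, (coprimeIndicator P ^ k) n / n := by
    have e : ∀ n : ℕ, Real.log n * (coprimeIndicator P ^ k) n = k * (coprimeIndicator P ^ k *
        ArithmeticFunction.vonMangoldt.pmul (coprimeIndicator P)) n := fun n => by
      have := congrArg (fun f : ArithmeticFunction ℝ => f n) (log_pmul_coprimeIndicator_pow P k)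
      simp only [ArithmeticFunction.pmul_apply, ArithmeticFunction.log_apply] at this
      rw [this, mul_comm (coprimeIndicator P ^ k), ArithmeticFunction.nsmul_apply]
    simp only [e]
    rw [← Finset.mul_sum, ArithmeticFunction.sum_Ioc_mul_eq_sum_sum, mul_assoc, mul_assoc]
    refine mul_le_mul_of_nonneg_left ?_ k.cast_nonneg
    rw [Finset.mul_sum, Finset.mul_sum]
    refine Finset.sum_le_sum fun n hn => ?_
    have hψ := Chebyshev.psi_le_const_mul_self (Nat.cast_nonneg (α := ℝ) (N / n))
    rw [Chebyshev.psi, Nat.floor_natCast] at hψ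
    have h2 : ∑ m ∈ Finset.Ioc 0 (N / n),
        ArithmeticFunction.vonMangoldt.pmul (coprimeIndicator P) m ≤
        (Real.log 4 + 4) * (N / n) := by
      calc _ ≤ ∑ m ∈ Finset.Ioc 0 (N / n), ArithmeticFunction.vonMangoldt m := by
            refine Finset.sum_le_sum fun m _ => ?_
            rw [ArithmeticFunction.pmul_apply]
            exact mul_le_of_le_one_right ArithmeticFunction.vonMangoldt_nonneg
              (coprimeIndicator_le_one P m)
        _ ≤ _ := hψ
        _ ≤ _ := by gcongr; exact Nat.cast_div_le
    calc _ ≤ (coprimeIndicator P ^ k) n * ((Real.log 4 + 4) * (N / n)) :=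
          mul_le_mul_of_nonneg_left h2 (hnn n)
      _ = _ := by ring
  have h2 : ∑ n ∈ Finset.Ioc 0 N, (Real.log N - Real.log n) * (coprimeIndicator P ^ k) n ≤
      N * ∑ n ∈ Finset.Ioc 0 N, (coprimeIndicator P ^ k) n / n := by
    rw [Finset.mul_sum]
    refine Finset.sum_le_sum fun n hn => ?_
    obtain ⟨hn0, hnN⟩ := Finset.mem_Ioc.1 hn
    have hn0' : (0 : ℝ) < n := by exact_mod_cast hn0
    have hN0' : (0 : ℝ) < N := by exact_mod_cast hn0.trans_le hnN
    have : Real.log N - Real.log n ≤ N / n := by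
      rw [← Real.log_div hN0'.ne' hn0'.ne']
      exact Real.log_le_self (by positivity)
    calc _ ≤ N / n * (coprimeIndicator P ^ k) n := mul_le_mul_of_nonneg_right this (hnn n)
      _ = _ := by ring
  have h3 := ArithmeticFunction.sum_pow_div_le he k N
  calc _ = ∑ n ∈ Finset.Ioc 0 N, Real.log n * (coprimeIndicator P ^ k) n +
        ∑ n ∈ Finset.Ioc 0 N, (Real.log N - Real.log n) * (coprimeIndicator P ^ k) n := by
        rw [← Finset.sum_add_distrib, Finset.sum_mul]
        exact Finset.sum_congr rfl fun n _ => by ring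
    _ ≤ (k * (Real.log 4 + 4) + 1) * N * ∑ n ∈ Finset.Ioc 0 N, (coprimeIndicator P ^ k) n / n := by
        linarith
    _ ≤ _ := by gcongr

theorem ArithmeticFunction.zeta_pow_succ_apply (m n : ℕ) :
    (zeta ^ (m + 1)) n = ∑ d ∈ n.divisors, (zeta ^ m) d := by
  rw [pow_succ', zeta_mul_apply]

open scoped Pointwise in
theorem ArithmeticFunction.zeta_pow_mul_le (m a b : ℕ) :
    (zeta ^ m) (a * b) ≤ (zeta ^ m) a * (zeta ^ m) b := by
  induction m generalizing a b with
  | zero =>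
    simp only [pow_zero, one_apply, mul_eq_one]
    split_ifs <;> simp_all
  | succ m ih =>
    simp only [zeta_pow_succ_apply]
    rw [Nat.divisors_mul, Finset.sum_mul_sum, ← Finset.sum_product']
    refine le_trans ?_ (Finset.sum_le_sum fun x _ => ih x.1 x.2)
    rw [← Finset.sum_fiberwise_of_maps_to (g := fun x : ℕ × ℕ => x.1 * x.2)
      (t := a.divisors * b.divisors) (fun x hx => Finset.mul_mem_mul (Finset.mem_product.1 hx).1
        (Finset.mem_product.1 hx).2)]
    refine Finset.sum_le_sum fun d hd => ?_
    obtain ⟨u, hu, v, hv, rfl⟩ := Finset.mem_mul.1 hd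
    refine Finset.single_le_sum (f := fun x : ℕ × ℕ => (zeta ^ m) (x.1 * x.2))
      (fun _ _ => Nat.zero_le _) (a := (u, v)) ?_
    exact Finset.mem_filter.2 ⟨Finset.mem_product.2 ⟨hu, hv⟩, rfl⟩

theorem ArithmeticFunction.zeta_pow_mul_zeta_pow_le (m k n : ℕ) :
    (zeta ^ m) n * (zeta ^ k) n ≤ (zeta ^ (m * k)) n := by
  induction k generalizing n with
  | zero =>
    by_cases h : n = 1
    · subst h
      have : ∀ m, (zeta ^ m) 1 = 1 := fun m => by
        induction m with
        | zero => simp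
        | succ m ih => simp [zeta_pow_succ_apply, ih]
      simp [this]
    · simp [h]
  | succ k ih =>
    rw [pow_succ, Nat.mul_succ, pow_add, mul_apply, mul_apply, Finset.mul_sum]
    refine Finset.sum_le_sum fun x hx => ?_
    obtain ⟨rfl, hn⟩ := Nat.mem_divisorsAntidiagonal.1 hx
    have hz : zeta x.2 = 1 := by simp [zeta_apply, right_ne_zero_of_mul hn]
    calc _ ≤ (zeta ^ m) x.1 * (zeta ^ m) x.2 * (zeta ^ k) x.1 := by
          rw [hz, mul_one]; gcongr; exact zeta_pow_mul_le m _ _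
      _ = (zeta ^ m) x.1 * (zeta ^ k) x.1 * (zeta ^ m) x.2 := by ring
      _ ≤ _ := by gcongr; exact ih _

theorem zeta_pow_apply_le_coprimeIndicator_pow {P n : ℕ} (hn : n.Coprime P) (k : ℕ) :
    (((ArithmeticFunction.zeta ^ k) n : ℕ) : ℝ) ≤ (coprimeIndicator P ^ k) n := by
  induction k generalizing n with
  | zero => simp [ArithmeticFunction.one_apply]
  | succ k ih =>
    rw [pow_succ, pow_succ, ArithmeticFunction.mul_apply, ArithmeticFunction.mul_apply,
      Nat.cast_sum]
    refine Finset.sum_le_sum fun x hx => ?_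
    obtain ⟨rfl, hn0⟩ := Nat.mem_divisorsAntidiagonal.1 hx
    obtain ⟨h1, h2⟩ := Nat.coprime_mul_iff_left.1 hn
    have hx2 := right_ne_zero_of_mul hn0
    have he : coprimeIndicator P x.2 = 1 := by
      rw [coprimeIndicator_apply, if_pos ⟨hx2, h2⟩]
    simpa [he, ArithmeticFunction.zeta_apply, hx2] using ih h1

theorem tauGen_le_zeta_pow (m : ℕ) {n : ℕ} (hn : n ≠ 0) :
    tauGen m n ≤ (ArithmeticFunction.zeta ^ m) n := by
  induction m generalizing n with
  | zero =>
    by_cases h : n = 1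
    · subst h; simp [tauGen]
    · simp [tauGen, Ne.symm h]
  | succ m ih =>
    rw [ArithmeticFunction.zeta_pow_succ_apply]
    refine le_trans ?_ (Finset.sum_le_sum fun d hd => ih (Nat.pos_of_mem_divisors hd).ne')
    simp only [tauGen]
    rw [← Finset.card_sigma]
    refine Finset.card_le_card_of_injOn (fun d => ⟨∏ i, Fin.tail d i, Fin.tail d⟩) ?_ ?_
    · intro d hd
      simp only [Finset.coe_filter, Fintype.mem_piFinset, Finset.mem_Icc, Set.mem_ofPred_eq,
        Fin.prod_univ_succ] at hd
      obtain ⟨hd1, hd2⟩ := hd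
      have hdv : ∏ i, Fin.tail d i ∣ n := ⟨d 0, by rw [← hd2, mul_comm]; rfl⟩
      simp only [Finset.coe_sigma, Set.mem_sigma_iff, Finset.mem_coe, Nat.mem_divisors,
        Finset.mem_filter, Fintype.mem_piFinset, Finset.mem_Icc, and_true]
      refine ⟨⟨hdv, hn⟩, fun i => ⟨(hd1 _).1, ?_⟩⟩
      exact Nat.le_of_dvd (Nat.pos_of_dvd_of_pos hdv (Nat.pos_of_ne_zero hn))
        (Finset.dvd_prod_of_mem _ (Finset.mem_univ i))
    · intro d hd d' hd' h
      simp only [Finset.coe_filter, Fintype.mem_piFinset, Finset.mem_Icc, Set.mem_ofPred_eq,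
        Fin.prod_univ_succ] at hd hd'
      have ht : Fin.tail d = Fin.tail d' := by
        simp only [Sigma.mk.injEq] at h
        exact eq_of_heq h.2
      have hpos : 0 < ∏ i, Fin.tail d i := Finset.prod_pos fun i _ => (hd.1 _).1
      have h0 : d 0 = d' 0 := by
        have e : d 0 * ∏ i, Fin.tail d i = d' 0 * ∏ i, Fin.tail d i := by
          conv_rhs => rw [ht]
          exact hd.2.trans hd'.2.symm
        exact Nat.eq_of_mul_eq_mul_right hpos e
      rw [← Fin.cons_self_tail d, ← Fin.cons_self_tail d', h0, ht]

/-- Weighted version of the second Mertens theorem: partial summation against `1 / log n`. -/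
theorem abs_sum_div_log_sub_log_log_le {a : ℕ → ℝ} (ha : a 1 = 0) {C : ℝ}
    (h : ∀ N : ℕ, 1 ≤ N → |∑ n ∈ Finset.Ioc 0 N, a n - Real.log N| ≤ C) (N : ℕ) (hN : 2 ≤ N) :
    |∑ n ∈ Finset.Ioc 0 N, a n / Real.log n - Real.log (Real.log N)
        - (∑ n ∈ Finset.Ioc 0 N, a n - Real.log N) / Real.log N - (1 - Real.log (Real.log 2))|
      ≤ (C + 1) * (1 / Real.log 2 - 1 / Real.log N) := by
  induction N, hN using Nat.le_induction with
  | base =>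
    have h2 : Real.log 2 ≠ 0 := (Real.log_pos (by norm_num)).ne'
    have : Finset.Ioc 0 2 = {1, 2} := by decide
    simp only [this, Nat.cast_ofNat, sub_self, mul_zero]
    rw [Finset.sum_pair (by norm_num), Finset.sum_pair (by norm_num), ha]
    rw [abs_nonpos_iff]
    field_simp
    push_cast
    ring
  | succ N hN ih =>
    have hR := h N (by omega)
    have hN' : (2 : ℝ) ≤ N := by exact_mod_cast hN
    rw [Finset.sum_Ioc_succ_top (by omega), Finset.sum_Ioc_succ_top (by omega)]
    set B := ∑ n ∈ Finset.Ioc 0 N, a n / Real.log n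
    set A := ∑ n ∈ Finset.Ioc 0 N, a n
    set u := Real.log N with hu
    set v := Real.log ((N + 1 : ℕ) : ℝ) with hv
    have hupos : 0 < u := Real.log_pos (by linarith)
    have huv : u ≤ v := Real.log_le_log (by linarith) (by push_cast; linarith)
    have hvpos : 0 < v := hupos.trans_le huv
    have huv1 : v - u ≤ 1 := by
      rw [hu, hv, ← Real.log_div (by positivity) (by positivity)]
      refine (Real.log_le_sub_one_of_pos (by positivity)).trans ?_
      push_cast
      rw [sub_le_iff_le_add, div_le_iff₀ (by linarith)]
      linarith
    have hD : 0 ≤ 1 / u - 1 / v := sub_nonneg.2 (one_div_le_one_div_of_le hupos huv)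
    have h1 : Real.log v - Real.log u ≤ (v - u) / u := by
      rw [← Real.log_div hvpos.ne' hupos.ne']
      refine (Real.log_le_sub_one_of_pos (by positivity)).trans (le_of_eq ?_)
      field_simp
    have h2 : (v - u) / v ≤ Real.log v - Real.log u := by
      have := Real.log_le_sub_one_of_pos (show 0 < u / v by positivity)
      rw [Real.log_div hupos.ne' hvpos.ne'] at this
      have e : (v - u) / v = 1 - u / v := by field_simp
      linarith
    have h3 : (v - u) / u - (v - u) / v ≤ 1 / u - 1 / v := by
      have : (v - u) / u - (v - u) / v = (v - u) * (1 / u - 1 / v) := by ring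
      rw [this]; exact mul_le_of_le_one_left hD huv1
    have hstep : B + a (N + 1) / v - Real.log v - (A + a (N + 1) - v) / v
          - (1 - Real.log (Real.log 2))
        = (B - Real.log u - (A - u) / u - (1 - Real.log (Real.log 2)))
          + (((v - u) / v - (Real.log v - Real.log u)) + (A - u) * (1 / u - 1 / v)) := by
      field_simp; ring
    have h4 : |(A - u) * (1 / u - 1 / v)| ≤ C * (1 / u - 1 / v) := by
      rw [abs_mul, abs_of_nonneg hD]; gcongr
    have h5 : |(v - u) / v - (Real.log v - Real.log u)| ≤ 1 / u - 1 / v := by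
      rw [abs_le]; constructor <;> linarith
    rw [hstep]
    refine (abs_add_le _ _).trans ((add_le_add ih (abs_add_le _ _)).trans ?_)
    linarith

/-- The first Mertens theorem. -/
theorem exists_abs_sum_log_div_sub_log_le :
    ∃ C : ℝ, ∀ N : ℕ, 1 ≤ N →
      |∑ p ∈ Finset.Ioc 0 N, (if p.Prime then Real.log p / p else 0) - Real.log N| ≤ C := by
  have hsum : Summable fun n : ℕ => 4 * ((n : ℝ) ^ (3 / 2 : ℝ))⁻¹ :=
    (Real.summable_nat_rpow_inv.2 (by norm_num)).mul_left 4
  set S := ∑' n : ℕ, 4 * ((n : ℝ) ^ (3 / 2 : ℝ))⁻¹ with hS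
  have hS0 : 0 ≤ S := tsum_nonneg fun n => by positivity
  refine ⟨Real.log 4 + 1 + S, fun N hN => ?_⟩
  have hNpos : (0 : ℝ) < N := by exact_mod_cast hN
  have hfac : Real.log (N.factorial) = ∑ p ∈ Finset.Ioc 0 N with p.Prime,
      (N.factorial.factorization p : ℝ) * Real.log p := by
    rw [Real.log_nat_eq_sum_factorization, Finsupp.sum]
    refine Finset.sum_subset (fun p hp => ?_) (fun p _ hp => ?_)
    · have hp' := Nat.prime_of_mem_primeFactors hp
      have := (hp'.dvd_factorial).1 (Nat.dvd_of_mem_primeFactors hp)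
      simp [hp', hp'.pos, this]
    · simp [Finsupp.notMem_support_iff.1 hp]
  have hup : Real.log (N.factorial) ≤ N * Real.log N := by
    rw [← Real.log_pow]
    refine Real.log_le_log (by positivity) ?_
    exact_mod_cast Nat.factorial_le_pow N
  have hlo : N * Real.log N - N ≤ Real.log (N.factorial) := by
    have := Real.pow_div_factorial_le_exp (N : ℝ) hNpos.le N
    have hNN : (0 : ℝ) < (N : ℝ) ^ N := by positivity
    have h := Real.log_le_log (by positivity) this
    rw [Real.log_exp, Real.log_div (by positivity) (by positivity), Real.log_pow] at h
    linarith
  rw [← Finset.sum_filter]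
  set A := ∑ p ∈ Finset.Ioc 0 N with p.Prime, Real.log p / p
  have h1 : N * A - Real.log 4 * N ≤ Real.log (N.factorial) := by
    have hth := Chebyshev.theta_le_log4_mul_x hNpos.le
    rw [Chebyshev.theta, Nat.floor_natCast] at hth
    rw [hfac]
    refine (sub_le_sub_left hth _).trans ?_
    rw [Finset.mul_sum, ← Finset.sum_sub_distrib]
    refine Finset.sum_le_sum fun p hp => ?_
    obtain ⟨hp1, hp⟩ := Finset.mem_filter.1 hp
    have hp0 : (0 : ℝ) < p := by exact_mod_cast hp.pos
    have hk : N / p ≤ N.factorial.factorization p := by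
      rw [Nat.factorization_factorial hp (Nat.lt_add_one (Nat.log p N))]
      have : N / p = N / p ^ 1 := by simp
      rw [this]
      refine Finset.single_le_sum (f := fun i => N / p ^ i) (fun _ _ => Nat.zero_le _) ?_
      have := Nat.log_pos hp.one_lt (Finset.mem_Ioc.1 hp1).2
      rw [Finset.mem_Ico]; omega
    have hk' : (N : ℝ) / p - 1 ≤ N.factorial.factorization p := by
      have := Nat.lt_floor_add_one ((N : ℝ) / p)
      rw [Nat.floor_div_natCast, Nat.floor_natCast] at this
      have : ((N / p : ℕ) : ℝ) ≤ N.factorial.factorization p := by exact_mod_cast hk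
      linarith
    have := mul_le_mul_of_nonneg_right hk' (Real.log_natCast_nonneg p)
    calc _ = ((N : ℝ) / p - 1) * Real.log p := by ring
      _ ≤ _ := this
  have h2 : Real.log (N.factorial) ≤ N * A + N * S := by
    have hS' : ∑ p ∈ Finset.Ioc 0 N with p.Prime, 4 * ((p : ℝ) ^ (3 / 2 : ℝ))⁻¹ ≤ S :=
      hsum.sum_le_tsum _ (fun n _ => by positivity)
    rw [hfac]
    refine le_trans ?_ (add_le_add_right (mul_le_mul_of_nonneg_left hS' hNpos.le) _)
    rw [Finset.mul_sum, Finset.mul_sum, ← Finset.sum_add_distrib]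
    refine Finset.sum_le_sum fun p hp => ?_
    obtain ⟨hp1, hp⟩ := Finset.mem_filter.1 hp
    have hp2 : (2 : ℝ) ≤ p := by exact_mod_cast hp.two_le
    have hk : (N.factorial.factorization p : ℝ) ≤ N / (p - 1) := by
      have := Nat.factorization_factorial_le_div_pred hp N
      have h' : ((N / (p - 1) : ℕ) : ℝ) ≤ (N : ℝ) / ((p - 1 : ℕ) : ℝ) := Nat.cast_div_le
      rw [Nat.cast_sub hp.one_le, Nat.cast_one] at h'
      exact le_trans (by exact_mod_cast this) h'
    have hlog : Real.log p ≤ 2 * (p : ℝ) ^ (1 / 2 : ℝ) := by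
      have := Real.log_le_rpow_div (x := p) (by linarith) (show (0 : ℝ) < 1 / 2 by norm_num)
      linarith
    have hl0 := Real.log_natCast_nonneg p
    have hpw : (p : ℝ) ^ (3 / 2 : ℝ) * (p : ℝ) ^ (1 / 2 : ℝ) = p ^ 2 := by
      rw [← Real.rpow_add (by linarith), ← Real.rpow_natCast]; norm_num
    have key : Real.log p / (p - 1) ≤ Real.log p / p + 4 * ((p : ℝ) ^ (3 / 2 : ℝ))⁻¹ := by
      have e1 : Real.log p / (p - 1) = Real.log p / p + Real.log p / (p * (p - 1)) := by
        have : (p : ℝ) - 1 ≠ 0 := by linarith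
        field_simp; ring
      have e2 : Real.log p / (p * (p - 1)) ≤ 4 * ((p : ℝ) ^ (3 / 2 : ℝ))⁻¹ := by
        have hz : 0 < (p : ℝ) ^ (3 / 2 : ℝ) := by positivity
        rw [← div_eq_mul_inv, div_le_div_iff₀ (by nlinarith) hz]
        calc Real.log p * (p : ℝ) ^ (3 / 2 : ℝ)
            ≤ 2 * (p : ℝ) ^ (1 / 2 : ℝ) * (p : ℝ) ^ (3 / 2 : ℝ) := by gcongr
          _ = 2 * p ^ 2 := by rw [← hpw]; ring
          _ ≤ _ := by nlinarith
      linarith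
    calc (N.factorial.factorization p : ℝ) * Real.log p ≤ N / (p - 1) * Real.log p := by gcongr
      _ = N * (Real.log p / (p - 1)) := by ring
      _ ≤ N * (Real.log p / p + 4 * ((p : ℝ) ^ (3 / 2 : ℝ))⁻¹) := by gcongr
      _ = _ := by ring
  have h3 : A ≤ Real.log N + Real.log 4 := by
    refine le_of_mul_le_mul_left ?_ hNpos
    linarith
  have h4 : Real.log N ≤ A + 1 + S := by
    refine le_of_mul_le_mul_left ?_ hNpos
    linarith
  have : 0 ≤ Real.log 4 := Real.log_nonneg (by norm_num)
  rw [abs_le]; constructor <;> linarith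

/-- The second Mertens theorem. -/
theorem exists_abs_sum_one_div_sub_log_log_le :
    ∃ C : ℝ, 0 ≤ C ∧ ∀ N : ℕ, 2 ≤ N →
      |∑ p ∈ Finset.Ioc 0 N with p.Prime, (1 / p : ℝ) - Real.log (Real.log N)| ≤ C := by
  obtain ⟨C, hC⟩ := exists_abs_sum_log_div_sub_log_le
  have hC0 : 0 ≤ C := (abs_nonneg _).trans (hC 1 le_rfl)
  have hl2 : 0 < Real.log 2 := Real.log_pos (by norm_num)
  refine ⟨|1 - Real.log (Real.log 2)| + C / Real.log 2 + (C + 1) / Real.log 2,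
    by positivity, fun N hN => ?_⟩
  have h := abs_sum_div_log_sub_log_log_le (by simp) hC N hN
  have hR := hC N (by omega)
  have hlN : Real.log 2 ≤ Real.log N :=
    Real.log_le_log (by norm_num) (by exact_mod_cast hN)
  have hlN0 := hl2.trans_le hlN
  have e : ∑ p ∈ Finset.Ioc 0 N, (if p.Prime then Real.log p / p else 0) / Real.log p
      = ∑ p ∈ Finset.Ioc 0 N with p.Prime, (1 / p : ℝ) := by
    rw [Finset.sum_filter]
    refine Finset.sum_congr rfl fun p _ => ?_
    split_ifs with hp
    · have : Real.log p ≠ 0 := (Real.log_pos (by exact_mod_cast hp.one_lt)).ne'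
      field_simp
    · simp
  rw [e] at h
  set R := ∑ p ∈ Finset.Ioc 0 N, (if p.Prime then Real.log p / p else 0) - Real.log N
  have hR' : |R / Real.log N| ≤ C / Real.log 2 := by
    rw [abs_div, abs_of_pos hlN0]; gcongr
  have hT : (C + 1) * (1 / Real.log 2 - 1 / Real.log N) ≤ (C + 1) / Real.log 2 := by
    rw [div_eq_mul_one_div (C + 1)]
    have : 0 < 1 / Real.log N := by positivity
    gcongr
    linarith
  have := abs_le.1 (h.trans hT)
  have := abs_le.1 hR'
  have := neg_abs_le (1 - Real.log (Real.log 2))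
  have := le_abs_self (1 - Real.log (Real.log 2))
  rw [abs_le]; constructor <;> linarith

theorem sum_one_div_mul_sub_one_le (N : ℕ) (hN : 1 ≤ N) :
    ∑ n ∈ Finset.Ioc 0 N, (1 / (n * (n - 1)) : ℝ) ≤ 1 - 1 / N := by
  induction N, hN using Nat.le_induction with
  | base => simp
  | succ N hN ih =>
    rw [Finset.sum_Ioc_succ_top (Nat.zero_le N)]
    have : (0 : ℝ) < N := by exact_mod_cast hN
    have e : (1 / (((N + 1 : ℕ) : ℝ) * (((N + 1 : ℕ) : ℝ) - 1)) : ℝ) = 1 / N - 1 / (N + 1 : ℕ) := by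
      push_cast
      rw [add_sub_cancel_right]
      field_simp
      ring
    linarith

/-- Euler product bound for the sum of reciprocals of the integers coprime to `P`. -/
theorem sum_coprimeIndicator_div_le (P N : ℕ) (hN : 1 ≤ N) :
    ∑ n ∈ Finset.Ioc 0 N, coprimeIndicator P n / n ≤
      Real.exp (1 + ∑ p ∈ Finset.Ioc 0 N with p.Prime ∧ ¬ p ∣ P, (1 / p : ℝ)) := by
  have he := coprimeIndicator_nonneg P
  let w : ℕ →* ℝ :=
    { toFun := fun n => coprimeIndicator P n / n
      map_one' := by simp [coprimeIndicator_apply]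
      map_mul' := fun a b => by rw [coprimeIndicator_mul, Nat.cast_mul, div_mul_div_comm] }
  have hw : ∀ n, w n = coprimeIndicator P n / n := fun n => rfl
  have hw0 : ∀ n, 0 ≤ w n := fun n => div_nonneg (he n) n.cast_nonneg
  have hw1 : ∀ n, w n ≤ 1 / n := fun n => by
    rw [hw]; gcongr; exact coprimeIndicator_le_one P n
  have hwp : ∀ {p : ℕ}, p.Prime → w p < 1 := fun {p} hp => by
    refine (hw1 p).trans_lt ?_
    have : (1 : ℝ) < p := by exact_mod_cast hp.one_lt
    rw [div_lt_one (by linarith)]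
    exact this
  have hprod := (EulerProduct.summable_and_hasSum_smoothNumbers_prod_primesBelow_geometric
    (f := w) (fun hp => by rw [Real.norm_of_nonneg (hw0 _)]; exact hwp hp) (N + 1)).2
  have h1 : ∑ n ∈ Finset.Ioc 0 N, w n ≤ ∏ p ∈ (N + 1).primesBelow, (1 - w p)⁻¹ := by
    have := sum_le_hasSum (Finset.Ioc 0 N)
      (fun n _ => Set.indicator_nonneg (fun n _ => hw0 n) n)
      (hasSum_subtype_iff_indicator.1 hprod)
    refine le_trans (Finset.sum_le_sum fun n hn => ?_) this
    obtain ⟨hn0, hnN⟩ := Finset.mem_Ioc.1 hn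
    rw [Set.indicator_of_mem]
    exact Nat.mem_smoothNumbers_of_lt hn0 (by omega)
  refine h1.trans ?_
  have h2 : ∏ p ∈ (N + 1).primesBelow, (1 - w p)⁻¹ ≤
      ∏ p ∈ Finset.Ioc 0 N with p.Prime,
        Real.exp (1 / (p * (p - 1)) + (if p ∣ P then 0 else 1 / p : ℝ)) := by
    rw [← Nat.primesLE_eq_filter_Ioc_zero, Nat.primesLE]
    refine Finset.prod_le_prod (fun p hp => ?_) (fun p hp => ?_)
    · have := hwp (Nat.prime_of_mem_primesBelow hp)
      exact inv_nonneg.2 (by linarith)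
    · have hpp := Nat.prime_of_mem_primesBelow hp
      have hp1 : (1 : ℝ) < p := by exact_mod_cast hpp.one_lt
      have hpos : 0 < (p : ℝ) * (p - 1) := mul_pos (by linarith) (by linarith)
      split_ifs with hd
      · have : w p = 0 := by
          rw [hw, coprimeIndicator_apply, if_neg, zero_div]
          rintro ⟨-, h⟩
          exact (hpp.coprime_iff_not_dvd.1 h) hd
        rw [this, sub_zero, inv_one, add_zero]
        exact Real.one_le_exp (by positivity)
      · have h3 : (1 - w p)⁻¹ ≤ (1 - 1 / p : ℝ)⁻¹ := by
          have : (1 / p : ℝ) < 1 := by rw [div_lt_one (by linarith)]; exact hp1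
          have h := hw1 p
          gcongr
        refine h3.trans (le_trans (le_of_eq ?_) (Real.add_one_le_exp _))
        have : (p : ℝ) - 1 ≠ 0 := by linarith
        field_simp
        ring
  refine h2.trans ?_
  rw [← Real.exp_sum, Finset.sum_add_distrib, Real.exp_le_exp]
  gcongr ?_ + ?_
  · have h3 := sum_one_div_mul_sub_one_le N hN
    have h4 : (0 : ℝ) ≤ 1 / N := by positivity
    refine le_trans (Finset.sum_le_sum_of_subset_of_nonneg (Finset.filter_subset _ _) ?_)
      (h3.trans (by linarith))
    intro n hn _
    have : (1 : ℝ) ≤ n := by exact_mod_cast (Finset.mem_Ioc.1 hn).1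
    exact div_nonneg zero_le_one (mul_nonneg (by linarith) (by linarith))
  · rw [← Finset.filter_filter, Finset.sum_filter (fun p => ¬ p ∣ P)]
    refine le_of_eq (Finset.sum_congr rfl fun p _ => ?_)
    split_ifs <;> rfl

theorem dvd_primeProdIcc {Y Z : ℝ} {p : ℕ} (hp : p.Prime) (hY : Y ≤ p) (hZ : (p : ℝ) ≤ Z) :
    p ∣ primeProdIcc Y Z := by
  refine Finset.dvd_prod_of_mem (fun p : ℕ => p) ?_
  simp only [Finset.mem_filter, Finset.mem_range, Nat.lt_succ_iff]
  exact ⟨Nat.le_floor hZ, hp, hY, hZ⟩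

theorem log_le_two_mul_log_floor {x : ℝ} (hx : 2 ≤ x) : Real.log x ≤ 2 * Real.log ⌊x⌋₊ := by
  have h2 : (2 : ℝ) ≤ ⌊x⌋₊ := by exact_mod_cast Nat.le_floor (by exact_mod_cast hx)
  have h := Nat.lt_floor_add_one x
  have : 2 * Real.log ⌊x⌋₊ = Real.log ((⌊x⌋₊ : ℝ) ^ 2) := by rw [Real.log_pow]; norm_num
  rw [this]
  exact Real.log_le_log (by linarith) (by nlinarith)

theorem exists_sum_coprimeIndicator_primeProdIcc_div_le :
    ∃ D : ℝ, 0 < D ∧ ∀ X Y Z : ℝ, 2 ≤ Y → Y < Z → Z ≤ X →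
      ∑ n ∈ Finset.Ioc 0 ⌊X⌋₊, coprimeIndicator (primeProdIcc Y Z) n / n ≤
        D * (Real.log X * (Real.log Y / Real.log Z)) := by
  obtain ⟨C, hC0, hC⟩ := exists_abs_sum_one_div_sub_log_log_le
  refine ⟨Real.exp (1 + 3 * C + Real.log 2), Real.exp_pos _, fun X Y Z hY hYZ hZX => ?_⟩
  have hZ : 2 ≤ Z := by linarith
  have hX : 2 ≤ X := by linarith
  have hlog : ∀ {x : ℝ}, 2 ≤ x → 0 < Real.log x := fun hx => Real.log_pos (by linarith)
  have hfl : ∀ {x : ℝ}, 2 ≤ x → 2 ≤ ⌊x⌋₊ := fun hx => Nat.le_floor (by exact_mod_cast hx)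
  have hfl' : ∀ {x : ℝ}, 2 ≤ x → (2 : ℝ) ≤ ⌊x⌋₊ := fun hx => by exact_mod_cast hfl hx
  have hup : ∀ {x : ℝ}, 2 ≤ x → Real.log (Real.log ⌊x⌋₊) ≤ Real.log (Real.log x) := fun {x} hx =>
    Real.log_le_log (hlog (hfl' hx))
      (Real.log_le_log (by linarith [hfl' hx]) (Nat.floor_le (by linarith)))
  have hlo : Real.log (Real.log Z) ≤ Real.log 2 + Real.log (Real.log ⌊Z⌋₊) := by
    rw [← Real.log_mul (by norm_num) (hlog (hfl' hZ)).ne']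
    exact Real.log_le_log (hlog hZ) (log_le_two_mul_log_floor hZ)
  set M : ℕ → ℝ := fun N => ∑ p ∈ Finset.Ioc 0 N with p.Prime, (1 / p : ℝ) with hM
  have hMd : M ⌊Y⌋₊ + ∑ p ∈ Finset.Ioc ⌊Y⌋₊ ⌊Z⌋₊ with p.Prime, (1 / p : ℝ) = M ⌊Z⌋₊ := by
    simp only [hM, Finset.sum_filter]
    exact Finset.sum_Ioc_consecutive _ (Nat.zero_le _) (Nat.floor_mono hYZ.le)
  have hsub : ∑ p ∈ Finset.Ioc 0 ⌊X⌋₊ with p.Prime ∧ ¬ p ∣ primeProdIcc Y Z, (1 / p : ℝ) +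
      ∑ p ∈ Finset.Ioc ⌊Y⌋₊ ⌊Z⌋₊ with p.Prime, (1 / p : ℝ) ≤ M ⌊X⌋₊ := by
    rw [← Finset.sum_union]
    · refine Finset.sum_le_sum_of_subset_of_nonneg ?_ fun p _ _ => by positivity
      have := Nat.floor_mono hZX
      intro p
      simp only [Finset.mem_union, Finset.mem_filter, Finset.mem_Ioc]
      rintro (⟨h, hp, -⟩ | ⟨h, hp⟩)
      · exact ⟨h, hp⟩
      · exact ⟨⟨hp.pos, h.2.trans this⟩, hp⟩
    · rw [Finset.disjoint_left]
      intro p hp hp'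
      simp only [Finset.mem_filter, Finset.mem_Ioc] at hp hp'
      refine hp.2.2 (dvd_primeProdIcc hp.2.1 ?_ ?_)
      · exact (Nat.lt_of_floor_lt hp'.1.1).le
      · exact (Nat.le_floor_iff (by linarith)).1 hp'.1.2
  have hMX := (abs_le.1 (hC _ (hfl hX))).2
  have hMY := (abs_le.1 (hC _ (hfl hY))).2
  have hMZ := (abs_le.1 (hC _ (hfl hZ))).1
  refine (sum_coprimeIndicator_div_le _ _ (one_le_two.trans (hfl hX))).trans ?_
  have e : Real.log X * (Real.log Y / Real.log Z) =
      Real.exp (Real.log (Real.log X) + Real.log (Real.log Y) - Real.log (Real.log Z)) := by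
    rw [Real.exp_sub, Real.exp_add, Real.exp_log (hlog hX), Real.exp_log (hlog hY),
      Real.exp_log (hlog hZ), mul_div_assoc]
  rw [e, ← Real.exp_add, Real.exp_le_exp]
  have := hup hX
  have := hup hY
  simp only [hM] at hMd hsub
  linarith

theorem sq_tauGen_le_coprimeIndicator_pow (m : ℕ) {P n : ℕ} (hn : n ≠ 0) (hP : n.Coprime P) :
    (tauGen m n : ℝ) ^ 2 ≤ (coprimeIndicator P ^ (m * m)) n := by
  refine le_trans ?_ (zeta_pow_apply_le_coprimeIndicator_pow hP (m * m))
  have h := tauGen_le_zeta_pow m hn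
  rw [sq]
  exact_mod_cast (Nat.mul_le_mul h h).trans (ArithmeticFunction.zeta_pow_mul_zeta_pow_le m m n)

/-- Sieve bound for `τ_m(n)²` over integers free of prime factors
in `[Y, Z]`. -/
theorem sieve_bound_tauGen (m : ℕ) (hm : 1 ≤ m) :
    ∃ C : ℝ, 0 < C ∧
      ∀ X Y Z : ℝ, 3 ≤ X → 2 ≤ Y → Y < Z → Z ≤ X →
      ∑ n ∈ (Finset.Icc 1 ⌊X⌋₊).filter
          (fun n : ℕ => Nat.gcd n (primeProdIcc Y Z) = 1),
        (tauGen m n : ℝ) ^ 2 ≤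
      C * X * (Real.log X) ^ ((m : ℝ) ^ 2 - 1) *
        (Real.log Y / Real.log Z) ^ ((m : ℝ) ^ 2) := by
  obtain ⟨D, hD, hH⟩ := exists_sum_coprimeIndicator_primeProdIcc_div_le
  have hl4 : 0 < Real.log 4 := Real.log_pos (by norm_num)
  refine ⟨2 * (((m * m : ℕ) : ℝ) * (Real.log 4 + 4) + 1) * D ^ (m * m), by positivity,
    fun X Y Z hX hY hYZ hZX => ?_⟩
  have hlX : 0 < Real.log X := Real.log_pos (by linarith)
  have hlY : 0 < Real.log Y := Real.log_pos (by linarith)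
  have hlZ : 0 < Real.log Z := Real.log_pos (by linarith)
  have hm2 : (m : ℝ) ^ 2 = ((m * m : ℕ) : ℝ) := by push_cast; ring
  rw [hm2, Real.rpow_sub_one hlX.ne', Real.rpow_natCast, Real.rpow_natCast]
  set P := primeProdIcc Y Z
  set k := m * m
  set c := (k : ℝ) * (Real.log 4 + 4) + 1
  set S := ∑ n ∈ Finset.Ioc 0 ⌊X⌋₊, (coprimeIndicator P ^ k) n
  have hnn := ArithmeticFunction.pow_apply_nonneg (coprimeIndicator_nonneg P) k
  have hS0 : 0 ≤ S := Finset.sum_nonneg fun n _ => hnn n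
  have h1 : ∑ n ∈ (Finset.Icc 1 ⌊X⌋₊).filter (fun n : ℕ => Nat.gcd n P = 1),
      (tauGen m n : ℝ) ^ 2 ≤ S := by
    refine le_trans (Finset.sum_le_sum (g := fun n => (coprimeIndicator P ^ k) n) fun n hn => ?_)
      (Finset.sum_le_sum_of_subset_of_nonneg (Finset.filter_subset _ _) fun n _ _ => hnn n)
    obtain ⟨hn1, hn2⟩ := Finset.mem_filter.1 hn
    exact sq_tauGen_le_coprimeIndicator_pow m (by have := Finset.mem_Icc.1 hn1; omega) hn2
  have h2 : S * (Real.log X / 2) ≤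
      c * X * (D * (Real.log X * (Real.log Y / Real.log Z))) ^ k := by
    have h3 := log_le_two_mul_log_floor (show 2 ≤ X by linarith)
    calc S * (Real.log X / 2) ≤ S * Real.log ⌊X⌋₊ := by gcongr; linarith
      _ ≤ _ := sum_coprimeIndicator_pow_mul_log_le P k ⌊X⌋₊
      _ ≤ _ := by
        have h4 : 0 ≤ ∑ n ∈ Finset.Ioc 0 ⌊X⌋₊, coprimeIndicator P n / n :=
          Finset.sum_nonneg fun n _ => div_nonneg (coprimeIndicator_nonneg P n) n.cast_nonneg
        have h5 : 0 ≤ c := by positivity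
        gcongr
        · exact Nat.floor_le (by linarith)
        · exact hH X Y Z hY hYZ hZX
  refine h1.trans ((le_div_iff₀ (by positivity)).2 h2 |>.trans (le_of_eq ?_))
  rw [mul_pow, mul_pow]
  field_simp
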